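/- Let (G,c) be a W-state graph whose monochromatic subgraph splits into factor-critical components on X and X' with min(|X|,|X'|) ≥ 3. Then G has a 2-vertex cut {x, x'} with x ∈ X and x' ∈ X'. -/

import Mathlib

/-! Multigraphs (parallel edges allowed, no loops) with half-edge 2-colourings,
    matchings, W-state graphs and W-cones, following the paper. -/

structure Multigraph (V E : Type) where
  fst : E → V
  snd : E → V
  no_loop : ∀ e, fst e ≠ snd e

namespace Multigraph

variable {V E : Type} (G : Multigraph V E)

/-- Edge `e` is incident with vertex `v`. -/
def Inc (e : E) (v : V) : Prop := G.fst e = v ∨ G.snd e = v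

/-- Adjacency using only edges in the edge set `F`. -/
def AdjIn (F : Set E) (u v : V) : Prop :=
  u ≠ v ∧ ∃ e ∈ F, G.Inc e u ∧ G.Inc e v

def Adj (u v : V) : Prop := G.AdjIn Set.univ u v

/-- Reachability inside the vertex set `S`, using only edges in `F`. -/
def ReachOn (F : Set E) (S : Set V) (u v : V) : Prop :=
  Relation.ReflTransGen (fun a b => a ∈ S ∧ b ∈ S ∧ G.AdjIn F a b) u v

/-- The subgraph with edge set `F` induced on the vertex set `S` is connected. -/
def ConnectedOn (F : Set E) (S : Set V) : Prop :=
  ∀ u ∈ S, ∀ v ∈ S, G.ReachOn F S u v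

def Connected : Prop := G.ConnectedOn Set.univ Set.univ

/-- `K` is a connected component of the subgraph with edge set `F` induced on `S`. -/
def IsCompOn (F : Set E) (S : Set V) (K : Set V) : Prop :=
  ∃ v ∈ S, K = {u | u ∈ S ∧ G.ReachOn F S u v}

def IsMatching (M : Set E) : Prop :=
  ∀ e ∈ M, ∀ f ∈ M, e ≠ f → ∀ v : V, ¬ (G.Inc e v ∧ G.Inc f v)

/-- `M` is a perfect matching of the subgraph of `G` induced on `S`. -/
def IsPerfectMatchingOn (S : Set V) (M : Set E) : Prop :=
  (∀ e ∈ M, G.fst e ∈ S ∧ G.snd e ∈ S) ∧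
  ∀ v ∈ S, ∃! e, e ∈ M ∧ G.Inc e v

def IsPerfectMatching (M : Set E) : Prop :=
  G.IsPerfectMatchingOn Set.univ M

/-- Every edge lies in some perfect matching. -/
def MatchingCovered : Prop :=
  ∀ e : E, ∃ M : Set E, G.IsPerfectMatching M ∧ e ∈ M

/-- The subgraph with edge set `F` induced on `K` is factor-critical. -/
def FactorCriticalOn (F : Set E) (K : Set V) : Prop :=
  ∀ v ∈ K, ∃ M : Set E, M ⊆ F ∧ G.IsPerfectMatchingOn (K \ {v}) M

def FactorCritical : Prop := G.FactorCriticalOn Set.univ Set.univ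

/-- `M` is a maximum matching among matchings using only edges in `F`. -/
def IsMaxMatchingIn (F M : Set E) : Prop :=
  M ⊆ F ∧ G.IsMatching M ∧
  ∀ N : Set E, N ⊆ F → G.IsMatching N → N.ncard ≤ M.ncard

/-- Half-edge 2-colourings are functions `c : E → V → Bool`
    (`true` = red, `false` = blue; only the values at endpoints matter). -/
def Bichromatic (c : E → V → Bool) (e : E) : Prop :=
  c e (G.fst e) ≠ c e (G.snd e)

/-- The monochromatic edges. -/
def MonoEdges (c : E → V → Bool) : Set E := {e | ¬ G.Bichromatic c e}

/-- Every vertex has an incident red half-edge. -/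
def VertexCond (c : E → V → Bool) : Prop :=
  ∀ v : V, ∃ e : E, G.Inc e v ∧ c e v = true

/-- Every perfect matching contains exactly one bichromatic edge. -/
def MatchingCond (c : E → V → Bool) : Prop :=
  ∀ M : Set E, G.IsPerfectMatching M → ∃! e, e ∈ M ∧ G.Bichromatic c e

/-- All monochromatic edges are blue. -/
def NoRedMono (c : E → V → Bool) : Prop :=
  ∀ e : E, ¬ G.Bichromatic c e → c e (G.fst e) = false

/-- W-state graph. -/
def IsWState (c : E → V → Bool) : Prop :=
  G.MatchingCovered ∧ G.MatchingCond c ∧ G.VertexCond c ∧ G.NoRedMono c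

def Universal (v : V) : Prop := ∀ u : V, u ≠ v → G.Adj u v

/-- W-cone with apex `v`. -/
def IsWConeWithApex (c : E → V → Bool) (v : V) : Prop :=
  G.MatchingCovered ∧ G.Universal v ∧
  (∀ e : E, G.Bichromatic c e ↔ G.Inc e v) ∧
  G.VertexCond c ∧ G.NoRedMono c

def IsWCone (c : E → V → Bool) : Prop := ∃ v : V, G.IsWConeWithApex c v

/-- `e` and `f` are parallel edges (same pair of endpoints). -/
def Parallel (e f : E) : Prop :=
  (G.fst e = G.fst f ∧ G.snd e = G.snd f) ∨
  (G.fst e = G.snd f ∧ G.snd e = G.fst f)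

/-- The cut `δ(X)`. -/
def CutEdges (X : Set V) : Set E :=
  {e | (G.fst e ∈ X ∧ G.snd e ∉ X) ∨ (G.fst e ∉ X ∧ G.snd e ∈ X)}

/-- `δ(X)` is a tight cut. -/
def IsTightCut (X : Set V) : Prop :=
  ∀ M : Set E, G.IsPerfectMatching M → ∃! e, e ∈ M ∧ e ∈ G.CutEdges X

def Bipartite : Prop :=
  ∃ f : V → Bool, ∀ e : E, f (G.fst e) ≠ f (G.snd e)

/-- A brick: non-bipartite matching-covered graph with no non-trivial tight cut. -/
def IsBrick : Prop :=
  G.MatchingCovered ∧ ¬ G.Bipartite ∧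
  ∀ X : Set V, 2 ≤ X.ncard → 2 ≤ (Set.univ \ X).ncard → ¬ G.IsTightCut X

end Multigraph

namespace WState

/-- `S` is the vertex set of a matching of `A`. -/
inductive Matchable {V : Type} [DecidableEq V] (A : SimpleGraph V) : Finset V → Prop
  | empty : Matchable A ∅
  | insert_edge {a b : V} {S : Finset V} : A.Adj a b → a ∉ S → b ∉ S → Matchable A S →
      Matchable A (insert a (insert b S))

section Matchable

variable {V : Type} [DecidableEq V] {A : SimpleGraph V}

theorem Matchable.add {a b : V} {S R : Finset V} (hS : Matchable A S) (hab : A.Adj a b)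
    (ha : a ∉ S) (hb : b ∉ S) (hR : R = insert a (insert b S)) : Matchable A R :=
  hR ▸ .insert_edge hab ha hb hS

theorem Matchable.even_card {S : Finset V} (hS : Matchable A S) : Even S.card := by
  induction hS with
  | empty => simp
  | insert_edge hab ha hb _ ih =>
    have := hab.ne
    rw [Finset.card_insert_of_notMem (by grind), Finset.card_insert_of_notMem hb]
    grind

theorem Matchable.exists_mate {S : Finset V} (hS : Matchable A S) {v : V} (hv : v ∈ S) :
    ∃ w ∈ S, A.Adj v w ∧ Matchable A (S \ {v, w}) := by
  induction hS with
  | empty => simp at hv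
  | @insert_edge a b S hab ha hb hS ih =>
    have hne := hab.ne
    by_cases hva : v = a
    · subst hva
      refine ⟨b, by simp, hab, ?_⟩
      rwa [show insert v (insert b S) \ {v, b} = S by grind]
    by_cases hvb : v = b
    · subst hvb
      refine ⟨a, by simp, hab.symm, ?_⟩
      rwa [show insert a (insert v S) \ {v, a} = S by grind]
    obtain ⟨w, hw, hvw, hm⟩ := ih (by grind)
    exact ⟨w, by grind, hvw, hm.add hab (by grind) (by grind) (by grind)⟩

theorem Matchable.exchange_aux (n : ℕ) : ∀ {S T : Finset V}, T.card = n → Matchable A S →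
    Matchable A T → ∀ {t : V}, t ∉ S → t ∈ T → ∃ t', t' ≠ t ∧ t' ∈ symmDiff S T ∧
      Matchable A (symmDiff S {t, t'}) ∧ Matchable A (symmDiff T {t, t'}) := by
  induction n using Nat.strong_induction_on with
  | _ n ih =>
    intro S T hn hS hT t htS htT
    obtain ⟨s, hsT, hts, hT'⟩ := hT.exists_mate htT
    have hne := hts.ne
    by_cases hsS : s ∈ S
    · obtain ⟨r, hrS, hsr, hS'⟩ := hS.exists_mate hsS
      have hne' := hsr.ne
      by_cases hrT : r ∈ T
      · obtain ⟨t', h1, h2, h3, h4⟩ := ih (T \ {t, s}).card (by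
          rw [← hn]; exact Finset.card_lt_card (by
            rw [Finset.ssubset_iff_of_subset (by grind)]; exact ⟨t, htT, by grind⟩))
          rfl hS' hT' (t := r) (by grind) (by grind)
        clear ih hn
        simp only [Finset.mem_symmDiff, Finset.mem_sdiff, Finset.mem_insert,
          Finset.mem_singleton, not_or] at h2
        have h2' : t' ≠ s ∧ t' ≠ t ∧ t' ≠ r ∧ (t' ∈ S ∧ t' ∉ T ∨ t' ∈ T ∧ t' ∉ S) := by
          rcases h2 with ⟨⟨h2, h2', h2''⟩, h5⟩ | ⟨⟨h2, h2', h2''⟩, h5⟩ <;>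
            grind
        clear h2
        obtain ⟨hs, ht, hr, h2⟩ := h2'
        refine ⟨t', ht, by simpa only [Finset.mem_symmDiff] using h2,
          h3.add hts ?_ ?_ ?_, h4.add hsr ?_ ?_ ?_⟩
        all_goals clear h3 h4 hS hT hS' hT'
        all_goals first
          | (ext x; simp only [Finset.mem_symmDiff, Finset.mem_insert, Finset.mem_sdiff,
              Finset.mem_singleton]; grind)
          | (simp only [Finset.mem_symmDiff, Finset.mem_insert, Finset.mem_sdiff,
              Finset.mem_singleton]; grind)
      · refine ⟨r, by grind, by simp only [Finset.mem_symmDiff]; grind,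
          hS'.add hts ?_ ?_ ?_, hT'.add hsr ?_ ?_ ?_⟩
        all_goals first
          | (ext x; simp only [Finset.mem_symmDiff, Finset.mem_insert, Finset.mem_sdiff,
              Finset.mem_singleton]; grind)
          | grind
    · refine ⟨s, hne.symm, by simp only [Finset.mem_symmDiff]; grind, hS.add hts htS hsS ?_, ?_⟩
      · ext x; simp only [Finset.mem_symmDiff, Finset.mem_insert, Finset.mem_singleton]; grind
      · rwa [show symmDiff T {t, s} = T \ {t, s} by
          ext x; simp only [Finset.mem_symmDiff, Finset.mem_insert, Finset.mem_sdiff,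
              Finset.mem_singleton]; grind]

/-- Simultaneous exchange: the vertex sets of matchings form an even delta-matroid. -/
theorem Matchable.exchange {S T : Finset V} (hS : Matchable A S) (hT : Matchable A T) {t : V}
    (ht : t ∈ symmDiff S T) : ∃ t', t' ≠ t ∧ t' ∈ symmDiff S T ∧
      Matchable A (symmDiff S {t, t'}) ∧ Matchable A (symmDiff T {t, t'}) := by
  rcases Finset.mem_symmDiff.1 ht with h | h
  · obtain ⟨t', h1, h2, h3, h4⟩ := Matchable.exchange_aux _ rfl hT hS h.2 h.1
    exact ⟨t', h1, by rwa [symmDiff_comm], h4, h3⟩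
  · exact Matchable.exchange_aux _ rfl hS hT h.2 h.1

theorem Matchable.inter {S U : Finset V} (hS : Matchable A S)
    (h : ∀ a ∈ S, ∀ b ∈ S, a ∈ U → b ∉ U → ¬ A.Adj a b) : Matchable A (S ∩ U) := by
  induction hS with
  | empty => simpa using Matchable.empty
  | @insert_edge a b S hab ha hb hS ih =>
    have ih := ih (by grind)
    have h1 := h a (by grind) b (by grind)
    have h2 := h b (by grind) a (by grind)
    have := hab.symm
    by_cases haU : a ∈ U
    · exact ih.add hab (by grind) (by grind) (by grind)
    · rwa [show insert a (insert b S) ∩ U = S ∩ U by grind]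

end Matchable

section Feasible

variable {V : Type} [DecidableEq V] {A : SimpleGraph V} {X : Finset V}

/-- `S` is a subset of `X` whose removal leaves the vertex set of a matching of `A`. -/
def Feasible (A : SimpleGraph V) (X S : Finset V) : Prop :=
  S ⊆ X ∧ Matchable A (X \ S)

theorem Feasible.odd_card {x : V} (h : Feasible A X {x}) : Odd X.card := by
  have h1 := h.2.even_card
  have h2 := Finset.card_sdiff_add_card_eq_card h.1
  rw [Finset.card_singleton] at h2
  grind

theorem Feasible.not_insert {S : Finset V} (h : Feasible A X S) {w : V} (hw : w ∉ S) :
    ¬ Feasible A X (insert w S) := by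
  intro h'
  have h1 := h.2.even_card
  have h2 := Finset.card_sdiff_add_card_eq_card h.1
  have h3 := h'.2.even_card
  have h4 := Finset.card_sdiff_add_card_eq_card h'.1
  rw [Finset.card_insert_of_notMem hw] at h4
  grind

theorem Feasible.exists_mate {S : Finset V} (h : Feasible A X S) {v : V} (hv : v ∈ X)
    (hvS : v ∉ S) : ∃ w ∈ X, w ∉ S ∧ w ≠ v ∧ A.Adj v w ∧
      Feasible A X (insert v (insert w S)) := by
  obtain ⟨w, hw, hvw, hm⟩ := h.2.exists_mate (v := v) (by grind)
  have := h.1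
  refine ⟨w, by grind, by grind, hvw.ne.symm, hvw, by grind, ?_⟩
  rwa [show X \ insert v (insert w S) = (X \ S) \ {v, w} by grind]

theorem Feasible.erase_edge {S R : Finset V} (h : Feasible A X S) {a b : V} (hab : A.Adj a b)
    (ha : a ∈ S) (hb : b ∈ S) (hR : ∀ x, x ∈ R ↔ x ∈ S ∧ x ≠ a ∧ x ≠ b) :
    Feasible A X R := by
  have := h.1
  have hne := hab.ne
  exact ⟨by grind, h.2.add hab (by grind) (by grind) (by grind)⟩

theorem Feasible.congr {S R : Finset V} (h : Feasible A X S) (hR : ∀ x, x ∈ R ↔ x ∈ S) :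
    Feasible A X R := by
  rwa [show R = S by grind]

theorem Feasible.exchange {S T : Finset V} (hS : Feasible A X S) (hT : Feasible A X T) {t : V}
    (ht : t ∈ S ∧ t ∉ T ∨ t ∈ T ∧ t ∉ S) :
    ∃ t', t' ≠ t ∧ (t' ∈ S ∧ t' ∉ T ∨ t' ∈ T ∧ t' ∉ S) ∧
      (∀ R : Finset V, (∀ x, x ∈ R ↔ (x ∈ S ∧ x ≠ t ∧ x ≠ t') ∨ (x ∉ S ∧ (x = t ∨ x = t'))) →
        Feasible A X R) ∧
      (∀ R : Finset V, (∀ x, x ∈ R ↔ (x ∈ T ∧ x ≠ t ∧ x ≠ t') ∨ (x ∉ T ∧ (x = t ∨ x = t'))) →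
        Feasible A X R) := by
  have hSX := hS.1
  have hTX := hT.1
  obtain ⟨t', hne, ht', h1, h2⟩ := hS.2.exchange hT.2 (t := t)
    (by simp only [Finset.mem_symmDiff]; grind)
  simp only [Finset.mem_symmDiff, Finset.mem_sdiff] at ht'
  refine ⟨t', hne, by grind, fun R hR => ⟨by grind, ?_⟩, fun R hR => ⟨by grind, ?_⟩⟩
  · convert h1 using 1
    ext x
    simp only [Finset.mem_symmDiff, Finset.mem_sdiff, Finset.mem_insert, Finset.mem_singleton, hR]
    grind
  · convert h2 using 1
    ext x
    simp only [Finset.mem_symmDiff, Finset.mem_sdiff, Finset.mem_insert, Finset.mem_singleton, hR]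
    grind

/-- A subset of `X` is feasible after deleting any single vertex. -/
def FactorCritical (A : SimpleGraph V) (X : Finset V) : Prop :=
  ∀ x ∈ X, Feasible A X {x}

theorem FactorCritical.exists_triple (hX : FactorCritical A X) {S : Finset V}
    (hS : Feasible A X S) {a b : V} (ha : a ∈ S) (hb : b ∈ S) (hab : a ≠ b) :
    ∃ d ∈ S, d ≠ a ∧ d ≠ b ∧ Feasible A X {a, b, d} := by
  obtain ⟨t', h1, h2, -, h4⟩ := hS.exchange (hX a (hS.1 ha)) (t := b) (by grind)
  exact ⟨t', by grind, by grind, h1, h4 _ (by grind)⟩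

theorem FactorCritical.not_feasible_pair (hX : FactorCritical A X) {a b : V} (hab : a ≠ b) :
    ¬ Feasible A X {a, b} := by
  intro h
  obtain ⟨d, hd, h1, h2, -⟩ := hX.exists_triple h (a := a) (b := b) (by grind) (by grind) hab
  grind

theorem FactorCritical.odd_card (hX : FactorCritical A X) (hne : X.Nonempty) :
    Odd X.card := by
  obtain ⟨x, hx⟩ := hne
  exact (hX x hx).odd_card

end Feasible

/-- `X` is the union of `U` and `W`, the elements of `U` are connected through pairs in `L`, and
no such pair forms a feasible triple with an element of `W`. -/
structure Linked {V : Type} [DecidableEq V] (A : SimpleGraph V) (X U W : Finset V)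
    (L : V → V → Prop) : Prop where
  mem_iff : ∀ x, x ∈ X ↔ x ∈ U ∨ x ∈ W
  factorCritical : FactorCritical A X
  avoid : ∀ u ∈ U, ∀ u' ∈ U, u ≠ u' → L u u' → ∀ w ∈ W, ¬ Feasible A X {w, u, u'}
  conn : ∀ Q : V → Prop, (∀ u ∈ U, ∀ u' ∈ U, u ≠ u' → L u u' → Q u → Q u') →
    ∀ u ∈ U, ∀ u' ∈ U, Q u → Q u'

namespace Linked

variable {V : Type} [DecidableEq V] {A : SimpleGraph V} {X U W : Finset V} {L : V → V → Prop}

theorem not_feasible_of_link (h : Linked A X U W L) {S : Finset V} {u u' : V} (hu : u ∈ U)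
    (hu' : u' ∈ U) (hne : u ≠ u') (hL : L u u') (huS : u ∈ S) (huS' : u' ∈ S)
    (hS : ∀ x ∈ S, x = u ∨ x = u' ∨ x ∈ W) : ¬ Feasible A X S := by
  intro hf
  obtain ⟨d, h1, h2, h3, h4⟩ := h.factorCritical.exists_triple hf huS huS' hne
  exact h.avoid u hu u' hu' hne hL d (by grind) (h4.congr (by grind))

theorem feasible_of_link (h : Linked A X U W L) {T : Finset V} (hT : T ⊆ W) {u u' : V}
    (hu : u ∈ U) (hu' : u' ∈ U) (hne : u ≠ u') (hL : L u u') (huT : u ∉ T)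
    (hf : Feasible A X (insert u T)) : Feasible A X (insert u' T) ∧ u' ∉ T := by
  by_cases huT' : u' ∈ T
  · exact absurd hf (h.not_feasible_of_link hu hu' hne hL (by grind) (by grind) (by grind))
  · refine ⟨?_, huT'⟩
    obtain ⟨t', h1, h2, h3, -⟩ := hf.exchange (h.factorCritical u' ((h.mem_iff _).2 (.inl hu')))
      (t := u') (by grind)
    by_cases htu : t' = u
    · exact h3 _ (by grind)
    · exact absurd (h3 (insert u (insert u' (T.erase t'))) (by grind))
        (h.not_feasible_of_link hu hu' hne hL (by grind) (by grind) (by grind))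

theorem feasible_of_feasible (h : Linked A X U W L) {T : Finset V} (hT : T ⊆ W) {u u' : V}
    (hu : u ∈ U) (hu' : u' ∈ U) (huT : u ∉ T)
    (hf : Feasible A X (insert u T)) : Feasible A X (insert u' T) ∧ u' ∉ T :=
  h.conn (fun u => Feasible A X (insert u T) ∧ u ∉ T)
    (fun _ hv _ hv' hne hL hQ => h.feasible_of_link hT hv hv' hne hL hQ.2 hQ.1) u hu u' hu'
    ⟨hf, huT⟩

/-- No larger subset of `W` than `T` is feasible together with an element of `U`. -/
def MaximalExtension (A : SimpleGraph V) (X U W T : Finset V) : Prop :=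
  ∀ T' ⊆ W, ∀ u ∈ U, Feasible A X (insert u T') → T'.card ≤ T.card

theorem MaximalExtension.not_feasible {T : Finset V} (hmax : MaximalExtension A X U W T)
    (hT : T ⊆ W) (p : V) (hp : p ∈ W) (hpT : p ∉ T) (q : V) (hq : q ∈ W) (hqT : q ∉ T)
    (hpq : p ≠ q) (u : V) (hu : u ∈ U) :
    ¬ Feasible A X (insert u (insert p (insert q T))) := by
  intro hf
  have := hmax (insert p (insert q T)) (by grind) u hu hf
  rw [Finset.card_insert_of_notMem (by grind), Finset.card_insert_of_notMem (by grind)] at this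
  omega

theorem exists_feasible_insert (h : Linked A X U W L) (hUW : ∀ u ∈ U, u ∉ W) {T : Finset V}
    (hT : T ⊆ W) (hf : ∀ u ∈ U, Feasible A X (insert u T)) {u₀ : V} (hu₀ : u₀ ∈ U)
    (hmax : MaximalExtension A X U W T)
    {w : V} (hw : w ∈ W) (hwT : w ∉ T) : ∃ w' ∈ W, w' ∉ T ∧ Feasible A X (insert w' T) := by
  by_contra! hno
  have hclosed : ∀ u ∈ U, (∀ w ∈ W, w ∉ T →
      ¬ Feasible A X (insert w (insert u₀ (insert u T)))) := by
    intro u hu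
    refine h.conn (fun u => ∀ w ∈ W, w ∉ T →
      ¬ Feasible A X (insert w (insert u₀ (insert u T)))) ?_ u₀ hu₀ u hu ?_
    · intro u hu u' hu' hne hL hQ w hw hwT hf'
      have hlink := fun S => h.not_feasible_of_link (S := S) hu hu' hne hL
      by_cases hu0 : u = u₀
      · exact hlink _ (by grind) (by grind) (by grind) hf'
      by_cases hu0' : u' = u₀
      · refine (hf u₀ hu₀).not_insert (w := w) (by grind) (hf'.congr (by grind))
      obtain ⟨t', h1, h2, h3, h4⟩ := hf'.exchange (hf u hu) (t := u) (by grind)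
      have h5 : t' = w ∨ t' = u₀ ∨ t' = u' := by grind
      rcases h5 with rfl | rfl | rfl
      · exact hno _ hw hwT (h4 _ (by grind))
      · exact hlink (insert w (insert u (insert u' T))) (by grind) (by grind) (by grind)
          (h3 _ (by grind))
      · exact hQ _ hw hwT (h3 _ (by grind))
    · intro w hw hwT hf'
      exact (hf u₀ hu₀).not_insert (w := w) (by grind) (hf'.congr (by grind))
  obtain ⟨m, hmX, hmT, hmw, -, hm⟩ := (hf u₀ hu₀).exists_mate (v := w)
    ((h.mem_iff _).2 (.inr hw)) (by grind)
  rcases (h.mem_iff m).1 hmX with hmU | hmW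
  · exact hclosed m hmU w hw hwT (hm.congr (by grind))
  · exact hmax.not_feasible hT w hw hwT m hmW (by grind) hmw.symm u₀ hu₀ (hm.congr (by grind))

theorem eq_of_notMem (h : Linked A X U W L) (hUW : ∀ u ∈ U, u ∉ W) {T : Finset V}
    (hT : T ⊆ W) {u₀ : V} (hu₀ : u₀ ∈ U) (hf : Feasible A X (insert u₀ T))
    (hmax : MaximalExtension A X U W T)
    {w w' : V} (hw : w ∈ W) (hwT : w ∉ T) (hfw : Feasible A X (insert w T))
    (hw' : w' ∈ W) (hwT' : w' ∉ T) : w' = w := by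
  by_contra hne
  obtain ⟨m, hmX, hmT, hmw, hwm, hm⟩ := hf.exists_mate (v := w)
    ((h.mem_iff _).2 (.inr hw)) (by grind)
  have hmU : m ∈ U := by
    rcases (h.mem_iff m).1 hmX with hmU | hmW
    · exact hmU
    · exact absurd (hm.congr (by grind))
        (hmax.not_feasible hT w hw hwT m hmW (by grind) hmw.symm u₀ hu₀)
  obtain ⟨n, hnX, hnT, hnw, -, hn⟩ := hm.exists_mate (v := w')
    ((h.mem_iff _).2 (.inr hw')) (by grind)
  have hnU : n ∈ U := by
    rcases (h.mem_iff n).1 hnX with hnU | hnW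
    · exact hnU
    · have hl := hmax.not_feasible hT w' hw' hwT' n hnW (by grind) hnw.symm u₀ hu₀
      exact absurd (hn.erase_edge hwm (by grind) (by grind) (by grind)) hl
  obtain ⟨t', h1, h2, h3, h4⟩ := hn.exchange hfw (t := u₀) (by grind)
  have h5 : t' = w' ∨ t' = m ∨ t' = n := by grind
  rcases h5 with rfl | rfl | rfl
  · exact hmax.not_feasible hT w hw hwT t' hw' hwT' (by grind) u₀ hu₀ (h4 _ (by grind))
  · exact hmax.not_feasible hT w hw hwT w' hw' hwT' (by grind) n hnU (h3 _ (by grind))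
  · exact hmax.not_feasible hT w hw hwT w' hw' hwT' (by grind) m hmU (h3 _ (by grind))

theorem feasible_insert_or (h : Linked A X U W L) (hUW : ∀ u ∈ U, u ∉ W) (hU : U.Nonempty) :
    (∀ u ∈ U, Feasible A X (insert u W)) ∨
      ∃ w₀ ∈ W, ∀ u ∈ U, Feasible A X (insert u (W.erase w₀)) := by
  classical
  obtain ⟨u₀, hu₀⟩ := hU
  obtain ⟨T, hT, hTmax⟩ := Finset.exists_max_image
    (W.powerset.filter fun T => Feasible A X (insert u₀ T)) Finset.card
    ⟨∅, by simpa using h.factorCritical u₀ ((h.mem_iff _).2 (.inl hu₀))⟩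
  simp only [Finset.mem_filter, Finset.mem_powerset] at hT hTmax
  obtain ⟨hTW, hf₀⟩ := hT
  have hmax : MaximalExtension A X U W T :=
    fun T' hT' u hu hf => hTmax T'
      ⟨hT', (h.feasible_of_feasible hT' hu hu₀ (by grind) hf).1⟩
  have hf : ∀ u ∈ U, Feasible A X (insert u T) := fun u hu =>
    (h.feasible_of_feasible hTW hu₀ hu (by grind) hf₀).1
  by_cases hW : W ⊆ T
  · left
    rwa [← hTW.antisymm hW]
  · right
    obtain ⟨w, hw, hwT⟩ := Finset.not_subset.1 hW
    obtain ⟨w₀, hw₀, hw₀T, hfw⟩ := h.exists_feasible_insert hUW hTW hf hu₀ hmax hw hwT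
    refine ⟨w₀, hw₀, fun u hu => (hf u hu).congr fun x => ?_⟩
    have := fun hx hxT => h.eq_of_notMem hUW hTW hu₀ hf₀ hmax hw₀ hw₀T hfw (w' := x) hx hxT
    grind

theorem not_feasible_of_adj (h : Linked A X U W L) (hUW : ∀ u ∈ U, u ∉ W) {a w u u' : V}
    (ha : a ∈ U) (hw : w ∈ W) (haw : A.Adj a w) (hu : u ∈ U) (hu' : u' ∈ U) (hne : u ≠ u')
    (hL : L u u') (hau : a ≠ u) (hau' : a ≠ u') : ¬ Feasible A X (insert a (insert u (insert u' W))) :=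
  fun hf => h.not_feasible_of_link (S := insert u (insert u' (W.erase w))) hu hu' hne hL
    (by grind) (by grind) (by grind) (hf.erase_edge haw (by grind) (by grind) (by grind))

theorem exists_attachment_left (h : Linked A X U W L) (hUW : ∀ u ∈ U, u ∉ W) (hU : U.Nonempty)
    (hf : ∀ u ∈ U, Feasible A X (insert u W)) :
    ∃ u₀ ∈ U, ∀ u ∈ U, ∀ w ∈ W, A.Adj u w → u = u₀ := by
  by_contra! hno
  obtain ⟨u₀, hu₀⟩ := hU
  obtain ⟨a, ha, w, hw, haw, -⟩ := hno u₀ hu₀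
  obtain ⟨b, hb, w', hw', hbw, hba⟩ := hno a ha
  clear hno
  obtain ⟨m, hmX, hmT, hmb, -, hm⟩ := (hf a ha).exists_mate (v := b)
    ((h.mem_iff _).2 (.inl hb)) (by grind)
  have hmU : m ∈ U := by
    have := h.mem_iff m
    grind
  have hQ := h.conn (fun u => u ≠ a ∧ u ≠ b ∧ Feasible A X (insert a (insert b (insert u W))))
    ?_ m hmU a ha ⟨by grind, by grind, hm.congr (by grind)⟩
  · exact hQ.1 rfl
  · rintro u hu u' hu' hne hL ⟨hua, hub, hQ⟩
    have hka := h.not_feasible_of_adj hUW ha hw haw hu hu' hne hL hua.symm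
    have hkb := h.not_feasible_of_adj hUW hb hw' hbw hu hu' hne hL hub.symm
    have hu'a : u' ≠ a := by
      rintro rfl
      exact hkb (by grind) (hQ.congr (by grind))
    have hu'b : u' ≠ b := by
      rintro rfl
      exact hka (by grind) (hQ.congr (by grind))
    refine ⟨hu'a, hu'b, ?_⟩
    obtain ⟨t', h1, h2, h3, -⟩ := hQ.exchange (hf u' hu') (t := u') (by grind)
    have h5 : t' = a ∨ t' = b ∨ t' = u := by grind
    rcases h5 with rfl | rfl | rfl
    · exact absurd (h3 _ (by grind)) (hkb hu'b.symm)
    · exact absurd (h3 _ (by grind)) (hka hu'a.symm)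
    · exact h3 _ (by grind)

theorem attachment_right (h : Linked A X U W L) (hUW : ∀ u ∈ U, u ∉ W) {w₀ : V} (hw₀ : w₀ ∈ W)
    (hf : ∀ u ∈ U, Feasible A X (insert u (W.erase w₀))) {u w : V} (hu : u ∈ U) (hw : w ∈ W)
    (huw : A.Adj u w) : w = w₀ := by
  by_contra hww
  have mem_left : ∀ m ∈ X, m ∉ W → m ∈ U := fun m hm hmW => by
    have := h.mem_iff m
    grind
  obtain ⟨a, haX, ha1, ha2, hwa, ha3⟩ := (hf u hu).exists_mate (v := w₀)
    ((h.mem_iff _).2 (.inr hw₀)) (by grind)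
  have ha : a ∈ U := mem_left a haX (by grind)
  have hfw : ∀ v ∈ U, Feasible A X (insert v (W.erase w)) := fun v hv =>
    (h.feasible_of_feasible (Finset.erase_subset _ _) ha hv (by grind)
      (ha3.erase_edge huw (by grind) (by grind) (by grind))).1
  have hQ := h.conn (fun v => v ≠ a ∧ Feasible A X (insert v (insert a W)))
    ?_ u hu a ha ⟨by grind, ha3.congr (by grind)⟩
  · exact hQ.1 rfl
  · rintro u hu u' hu' hne hL ⟨hua, hQ⟩
    have hlink := fun S => h.not_feasible_of_link (S := S) hu hu' hne hL
    have hu'a : u' ≠ a := by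
      rintro rfl
      exact hlink _ (by grind) (by grind) (by grind) hQ
    refine ⟨hu'a, ?_⟩
    obtain ⟨b, hbX, hb1, hb2, hwb, hb3⟩ := (hfw u' hu').exists_mate (v := w)
      ((h.mem_iff _).2 (.inr hw)) (by grind)
    have hb : b ∈ U := mem_left b hbX (by grind)
    by_cases hba : b = a
    · exact hb3.congr (by grind)
    have hbu : b ≠ u := by
      rintro rfl
      exact hlink _ (by grind) (by grind) (by grind) hb3
    obtain ⟨t', h1, h2, h3, h4⟩ := hQ.exchange hb3 (t := u) (by grind)
    have h5 : t' = a ∨ t' = u' ∨ t' = b := by grind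
    rcases h5 with rfl | rfl | rfl
    · have h6 := h4 (insert u (insert u' (insert b (insert t' W)))) (by grind)
      have h7 := h6.erase_edge (R := insert u (insert u' (insert b (W.erase w₀)))) hwa
        (by grind) (by grind) (by grind)
      have h8 := h7.erase_edge (R := insert u (insert u' ((W.erase w₀).erase w))) hwb
        (by grind) (by grind) (by grind)
      exact absurd h8 (hlink _ (by grind) (by grind) (by grind))
    · exact h3 _ (by grind)
    · exact absurd (h4 (insert u (insert u' W)) (by grind))
        (hlink _ (by grind) (by grind) (by grind))

end Linked

section Pendant

variable {V : Type} [DecidableEq V] {A H : SimpleGraph V} {X K : Finset V} {z : V}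

/-- `K` is a nonempty subset of `X` that avoids `z` and is closed under the relation of forming
a feasible triple with `z`. -/
structure Pendant (A : SimpleGraph V) (X : Finset V) (z : V) (K : Finset V) : Prop where
  root_mem : z ∈ X
  subset : K ⊆ X
  root_notMem : z ∉ K
  nonempty : K.Nonempty
  closed : ∀ v ∈ K, ∀ v', Feasible A X {z, v, v'} → v' ∈ K

theorem FactorCritical.pendant_erase (hX : FactorCritical A X) (hz : z ∈ X)
    (hcard : 3 ≤ X.card) : Pendant A X z (X.erase z) where
  root_mem := hz
  subset := Finset.erase_subset _ _
  root_notMem := by simp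
  nonempty := by
    rw [← Finset.card_pos, Finset.card_erase_of_mem hz]
    omega
  closed v hv v' hf := by
    have := hf.1
    refine Finset.mem_erase.2 ⟨?_, this (by simp)⟩
    rintro rfl
    exact hX.not_feasible_pair (a := v') (b := v) (by grind) (hf.congr (by grind))

theorem FactorCritical.ne_of_feasible (hX : FactorCritical A X) {a b d : V}
    (hf : Feasible A X {a, b, d}) (hab : a ≠ b) : d ≠ a ∧ d ≠ b := by
  refine ⟨?_, ?_⟩ <;> rintro rfl <;>
    exact hX.not_feasible_pair hab (hf.congr (by grind))

theorem FactorCritical.exists_feasible (hX : FactorCritical A X) {a b : V} (ha : a ∈ X)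
    (hb : b ∈ X) (hab : a ≠ b) : ∃ d ∈ X, Feasible A X {a, b, d} := by
  obtain ⟨d, hd, -, -, -, hf⟩ := (hX a ha).exists_mate hb (by grind)
  exact ⟨d, hd, hf.congr (by grind)⟩

namespace Pendant

theorem feasible_of_feasible (h : Pendant A X z K) (hX : FactorCritical A X) {y v v' : V}
    (hy : y ∈ X) (hyK : y ∉ K) (hv : v ∈ K) (hv' : v' ∈ K)
    (hf : Feasible A X {z, v, v'}) : Feasible A X {y, v, v'} := by
  by_cases hyz : y = z
  · rwa [hyz]
  have hz := h.root_notMem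
  have hne := hX.ne_of_feasible hf (by grind)
  obtain ⟨t', h1, h2, h3, -⟩ := hf.exchange (hX y hy) (t := y) (by grind)
  have h5 : t' = z ∨ t' = v ∨ t' = v' := by grind
  rcases h5 with rfl | rfl | rfl
  · exact h3 _ (by grind)
  · exact absurd (h.closed v' hv' y (h3 _ (by grind))) hyK
  · exact absurd (h.closed v hv y (h3 _ (by grind))) hyK

theorem not_adj (h : Pendant A X z K) (hX : FactorCritical A X) {v y : V} (hv : v ∈ K)
    (hy : y ∈ X) (hyK : y ∉ K) (hyz : y ≠ z) : ¬ A.Adj v y := by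
  intro hvy
  have hz := h.root_notMem
  obtain ⟨m, hmX, hm1, hm2, hvm, hf⟩ := (hX z h.root_mem).exists_mate (h.subset hv) (by grind)
  have hmK : m ∈ K := h.closed v hv m (hf.congr (by grind))
  obtain ⟨n, hnX, hn1, hn2, hyn, hf'⟩ := hf.exists_mate hy (by grind)
  have hnK : n ∈ K := h.closed m hmK n
    (hf'.erase_edge hvy (by grind) (by grind) (by grind))
  exact hyK (h.closed n hnK y (hf'.erase_edge hvm (by grind) (by grind) (by grind)))

end Pendant

end Pendant

section Incidence

variable {V : Type} {H : SimpleGraph V} {K : Finset V}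

/-- The number of pairs of an edge of `H` and an endpoint of it in `K`. -/
noncomputable def incidence (H : SimpleGraph V) (K : Finset V) : ℕ :=
  Set.ncard {p : V × V | p.2 ∈ K ∧ H.Adj p.1 p.2}

theorem incidence_eq_swap (K : Finset V) :
    incidence H K = Set.ncard {p : V × V | p.1 ∈ K ∧ H.Adj p.1 p.2} := by
  rw [incidence, ← Set.ncard_image_of_injective _ Prod.swap_injective]
  congr 1
  ext ⟨a, b⟩
  simp [H.adj_comm]

variable [Finite V]

theorem incidence_lt_of_subset {K' : Finset V} (h : K' ⊆ K) {v u : V} (hv : v ∈ K)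
    (hv' : v ∉ K') (huv : H.Adj u v) : incidence H K' < incidence H K := by
  refine Set.ncard_lt_ncard ?_ (Set.toFinite _)
  refine ⟨fun p hp => ⟨h hp.1, hp.2⟩, fun hsub => ?_⟩
  exact hv' (hsub (show ((u, v) : V × V) ∈ {p : V × V | p.2 ∈ K ∧ H.Adj p.1 p.2} from
    ⟨hv, huv⟩)).1

theorem incidence_lt_of_neighbors {K' : Finset V} (h : ∀ u ∈ K', ∀ v, H.Adj u v → v ∈ K)
    {u v : V} (hu : u ∉ K') (hv : v ∈ K) (huv : H.Adj u v) :
    incidence H K' < incidence H K := by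
  rw [incidence_eq_swap K']
  refine Set.ncard_lt_ncard ?_ (Set.toFinite _)
  refine ⟨fun p hp => ⟨h _ hp.1 _ hp.2, hp.2⟩, fun hsub => ?_⟩
  exact hu (hsub (show ((u, v) : V × V) ∈ {p : V × V | p.2 ∈ K ∧ H.Adj p.1 p.2} from
    ⟨hv, huv⟩)).1

theorem incidence_erase_add [DecidableEq V] {v : V} (hv : v ∈ K) :
    incidence H (K.erase v) + {u | H.Adj u v}.ncard = incidence H K := by
  rw [incidence, incidence, ← Set.ncard_image_of_injective {u | H.Adj u v}
    (Prod.mk_left_injective v), ← Set.ncard_union_eq]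
  · congr 1
    ext ⟨a, b⟩
    simp only [Finset.mem_erase, Set.mem_union, Set.mem_ofPred_eq, Set.mem_image, Prod.mk.injEq]
    grind
  · rw [Set.disjoint_left]
    rintro ⟨a, b⟩ h1 ⟨c, -, h2⟩
    simp at h1 h2
    grind

end Incidence

theorem Pendant.conn {V : Type} [DecidableEq V] [Finite V] {A H : SimpleGraph V}
    {X K : Finset V} {z : V} (h : Pendant A X z K)
    (hmin : ∀ K', Pendant A X z K' → incidence H K ≤ incidence H K')
    (hH : ∀ v ∈ K, ∃ u, H.Adj u v) (R : V → Prop)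
    (hR : ∀ v ∈ K, ∀ v' ∈ K, Feasible A X {z, v, v'} → R v → R v') {v v' : V} (hv : v ∈ K)
    (hv' : v' ∈ K) (hRv : R v) : R v' := by
  classical
  by_contra hRv'
  obtain ⟨u, hu⟩ := hH v' hv'
  refine (incidence_lt_of_subset (K' := K.filter R) (by grind) hv' (by grind) hu).not_ge
    (hmin _ ⟨h.root_mem, (Finset.filter_subset _ _).trans h.subset, ?_, ⟨v, by grind⟩, ?_⟩)
  · have := h.root_notMem
    grind
  · intro a ha b hf
    rw [Finset.mem_filter] at ha ⊢
    have hb := h.closed a ha.1 b hf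
    exact ⟨hb, hR a ha.1 b hb hf ha.2⟩

/-- Graphs `A` and `H` on a vertex set split into `X` and `X'`: the edges of `A` stay inside a
part, those of `H` join the two parts, both parts are factor-critical in `A`, and no perfect
matching of `A ⊔ H` uses three or more edges of `H`, in the local form recorded by
`not_feasible` and `not_perfect`. -/
structure Split {V : Type} [DecidableEq V] (A H : SimpleGraph V) (X X' : Finset V) : Prop where
  disjoint : ∀ v ∈ X, v ∉ X'
  cover : ∀ v, v ∈ X ∨ v ∈ X'
  inner : ∀ a b, A.Adj a b → (a ∈ X ↔ b ∈ X)
  cross : ∀ a b, H.Adj a b → (a ∈ X ↔ b ∈ X')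
  exists_adj : ∀ v, ∃ w, H.Adj w v
  left : FactorCritical A X
  right : FactorCritical A X'
  card_left : 3 ≤ X.card
  card_right : 3 ≤ X'.card
  not_feasible : ∀ x₁ x₂ x₃ y₁ y₂ y₃, x₁ ≠ x₂ → x₁ ≠ x₃ → x₂ ≠ x₃ → y₁ ≠ y₂ → y₁ ≠ y₃ →
    y₂ ≠ y₃ → H.Adj x₁ y₁ → H.Adj x₂ y₂ → H.Adj x₃ y₃ → Feasible A X {x₁, x₂, x₃} →
    ¬ Feasible A X' {y₁, y₂, y₃}
  not_perfect : ¬ ∀ v, ∃! w, H.Adj w v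

/-- Some `x ∈ X` and `x' ∈ X'` separate the union of the graphs `A` and `H`. -/
def HasCut {V : Type} (A H : SimpleGraph V) (X X' : Finset V) : Prop :=
  ∃ x ∈ X, ∃ x' ∈ X', ∃ C : Set V, x ∉ C ∧ x' ∉ C ∧ (∃ p, p ∈ C) ∧
    (∃ q, q ∉ C ∧ q ≠ x ∧ q ≠ x') ∧
    ∀ a ∈ C, ∀ b, b ∉ C → b ≠ x → b ≠ x' → ¬ A.Adj a b ∧ ¬ H.Adj a b

theorem HasCut.symm {V : Type} {A H : SimpleGraph V} {X X' : Finset V} (h : HasCut A H X X') :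
    HasCut A H X' X := by
  obtain ⟨x, hx, x', hx', C, h1, h2, h3, ⟨q, h4, h5, h6⟩, h7⟩ := h
  exact ⟨x', hx', x, hx, C, h2, h1, h3, ⟨q, h4, h6, h5⟩,
    fun a ha b hb hbx hbx' => h7 a ha b hb hbx' hbx⟩

namespace Split

variable {V : Type} [DecidableEq V] {A H : SimpleGraph V} {X X' : Finset V}

theorem symm (h : Split A H X X') : Split A H X' X where
  disjoint v hv hv' := h.disjoint v hv' hv
  cover v := (h.cover v).symm
  inner a b hab := by
    have := h.inner a b hab
    have := h.disjoint
    have := h.cover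
    grind
  cross a b hab := (h.cross b a hab.symm).symm
  exists_adj := h.exists_adj
  left := h.right
  right := h.left
  card_left := h.card_right
  card_right := h.card_left
  not_feasible x₁ x₂ x₃ y₁ y₂ y₃ h1 h2 h3 h4 h5 h6 a1 a2 a3 hx hy :=
    h.not_feasible y₁ y₂ y₃ x₁ x₂ x₃ h4 h5 h6 h1 h2 h3 a1.symm a2.symm a3.symm hy hx
  not_perfect := h.not_perfect

theorem mem_left_of_adj (h : Split A H X X') {u v : V} (hv : v ∈ X') (huv : H.Adj u v) :
    u ∈ X :=
  (h.cross u v huv).2 hv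

theorem mem_right_of_adj (h : Split A H X X') {u v : V} (hv : v ∈ X) (huv : H.Adj u v) :
    u ∈ X' :=
  h.symm.mem_left_of_adj hv huv

theorem mem_right_of_inner (h : Split A H X X') {u v : V} (hu : u ∈ X') (huv : A.Adj u v) :
    v ∈ X' :=
  (h.symm.inner u v huv).1 hu

end Split

/-- A pendant set on the side `X'` with the least incidence among those on both sides,
together with the sets `U` of neighbours of `K` and `W` of neighbours of the rest of `X'`. -/
structure MinimalPendant {V : Type} [DecidableEq V] (A H : SimpleGraph V) (X X' : Finset V)
    (z : V) (K U W : Finset V) : Prop where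
  split : Split A H X X'
  pendant : Pendant A X' z K
  min_left : ∀ z' K', Pendant A X z' K' → incidence H K ≤ incidence H K'
  min_right : ∀ z' K', Pendant A X' z' K' → incidence H K ≤ incidence H K'
  mem_inner : ∀ u, u ∈ U ↔ ∃ v ∈ K, H.Adj u v
  mem_outer : ∀ w, w ∈ W ↔ ∃ y ∈ X', y ∉ K ∧ H.Adj w y

namespace MinimalPendant

variable {V : Type} [DecidableEq V] {A H : SimpleGraph V} {X X' : Finset V}
  {z : V} {K U W : Finset V}

theorem mem_iff (h : MinimalPendant A H X X' z K U W) (x : V) : x ∈ X ↔ x ∈ U ∨ x ∈ W := by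
  constructor
  · intro hx
    obtain ⟨y, hy⟩ := h.split.exists_adj x
    have hyX := h.split.mem_right_of_adj hx hy
    by_cases hyK : y ∈ K
    · exact .inl ((h.mem_inner x).2 ⟨y, hyK, hy.symm⟩)
    · exact .inr ((h.mem_outer x).2 ⟨y, hyX, hyK, hy.symm⟩)
  · rintro (hx | hx)
    · obtain ⟨v, hv, hxv⟩ := (h.mem_inner x).1 hx
      exact h.split.mem_left_of_adj (h.pendant.subset hv) hxv
    · obtain ⟨v, hv, -, hxv⟩ := (h.mem_outer x).1 hx
      exact h.split.mem_left_of_adj hv hxv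

theorem hasCut_of_singleton (h : MinimalPendant A H X X' z K U W) {u : V} (hu : u ∈ U)
    (hU : ∀ u' ∈ U, u' = u) : HasCut A H X X' := by
  have huX := (h.mem_iff u).2 (.inl hu)
  obtain ⟨p, hp⟩ := h.pendant.nonempty
  have hKX : ∀ v ∈ K, v ∉ X := fun v hv hvX =>
    h.split.disjoint v hvX (h.pendant.subset hv)
  refine ⟨u, huX, z, h.pendant.root_mem, K, fun huK => hKX u huK huX, h.pendant.root_notMem,
    ⟨p, hp⟩, ?_, ?_⟩
  · have hcard := h.split.card_left
    obtain ⟨q, hq⟩ : (X.erase u).Nonempty := by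
      rw [← Finset.card_pos, Finset.card_erase_of_mem huX]
      omega
    rw [Finset.mem_erase] at hq
    refine ⟨q, fun hqK => hKX q hqK hq.2, hq.1, ?_⟩
    rintro rfl
    exact h.split.disjoint q hq.2 h.pendant.root_mem
  · intro a ha b hb hbu hbz
    refine ⟨fun hab => ?_, fun hab => hbu (hU b ((h.mem_inner b).2 ⟨a, ha, hab.symm⟩))⟩
    exact h.pendant.not_adj h.split.right ha
      (h.split.mem_right_of_inner (h.pendant.subset ha) hab) hb hbz hab

variable [Finite V]

theorem linked (h : MinimalPendant A H X X' z K U W) :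
    Linked A X U W fun u u' => ∃ v ∈ K, ∃ v' ∈ K, H.Adj u v ∧ H.Adj u' v' ∧
      Feasible A X' {z, v, v'} where
  mem_iff := h.mem_iff
  factorCritical := h.split.left
  avoid u _ u' _ hne := by
    rintro ⟨v, hv, v', hv', huv, huv', hf⟩ w hw hfw
    obtain ⟨y, hyX, hyK, hwy⟩ := (h.mem_outer w).1 hw
    have hne' := h.split.left.ne_of_feasible (a := u) (b := u') (d := w)
      (hfw.congr (by grind)) hne
    have hvv' := h.split.right.ne_of_feasible hf (by
      have := h.pendant.root_notMem
      grind)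
    exact h.split.not_feasible w u u' y v v' hne'.1 hne'.2 hne (by grind) (by grind)
      hvv'.2.symm hwy huv huv' hfw
      (h.pendant.feasible_of_feasible h.split.right hyX hyK hv hv' hf)
  conn Q hQ u hu u' hu' hQu := by
    have hQ' : ∀ v ∈ K, ∀ v' ∈ K, Feasible A X' {z, v, v'} → ∀ a, H.Adj a v → Q a →
        ∀ b, H.Adj b v' → Q b := by
      intro v hv v' hv' hf a hav hQa b hbv
      by_cases hab : a = b
      · rwa [← hab]
      · exact hQ a ((h.mem_inner a).2 ⟨v, hv, hav⟩) b ((h.mem_inner b).2 ⟨v', hv', hbv⟩) hab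
          ⟨v, hv, v', hv', hav, hbv, hf⟩ hQa
    obtain ⟨v, hv, huv⟩ := (h.mem_inner u).1 hu
    obtain ⟨v', hv', huv'⟩ := (h.mem_inner u').1 hu'
    obtain ⟨m, hm, hf⟩ := h.split.right.exists_feasible h.pendant.root_mem
      (h.pendant.subset hv) (by
        have := h.pendant.root_notMem
        grind)
    have hmK := h.pendant.closed v hv m hf
    refine h.pendant.conn (h.min_right z) (fun v _ => h.split.exists_adj v)
      (fun v => ∀ a, H.Adj a v → Q a) ?_ hmK hv' (hQ' v hv m hmK hf u huv hQu) u' huv'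
    intro a ha b hb hf' hRa
    obtain ⟨p, hp⟩ := h.split.exists_adj a
    exact hQ' a ha b hb hf' p hp (hRa p hp)

theorem hasCut_of_closed (h : MinimalPendant A H X X' z K U W) {u : V} (hu : u ∈ U)
    (hUW : ∀ u' ∈ U, u' ∈ W → u' = u)
    (hclosed : ∀ v ∈ U, v ≠ u → ∀ w ∈ W, ¬ Feasible A X {u, v, w}) : HasCut A H X X' := by
  by_cases hU : ∀ u' ∈ U, u' = u
  · exact h.hasCut_of_singleton hu hU
  push Not at hU
  obtain ⟨v₀, hv₀, hne⟩ := hU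
  have huX := (h.mem_iff u).2 (.inl hu)
  have hp : Pendant A X u (U.erase u) := by
    refine ⟨huX, fun x hx => (h.mem_iff x).2 (by grind), by simp, ⟨v₀, by grind⟩, ?_⟩
    intro v hv v' hf
    rw [Finset.mem_erase] at hv ⊢
    refine ⟨(h.split.left.ne_of_feasible hf hv.1.symm).1, ?_⟩
    refine ((h.mem_iff v').1 (hf.1 (by simp))).resolve_right fun hv'W => ?_
    exact hclosed v hv.2 hv.1 v' hv'W hf
  obtain ⟨v, hv, huv⟩ := (h.mem_inner u).1 hu
  refine absurd (h.min_left _ _ hp) (not_le.2 (incidence_lt_of_neighbors ?_ (by simp) hv huv))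
  intro a ha b hab
  by_contra hbK
  rw [Finset.mem_erase] at ha
  refine ha.1 (hUW a ha.2 ((h.mem_outer a).2 ⟨b, ?_, hbK, hab⟩))
  exact h.split.mem_right_of_adj ((h.mem_iff a).2 (.inl ha.2)) hab.symm

theorem hasCut_of_inter (h : MinimalPendant A H X X' z K U W) {u : V} (hu : u ∈ U)
    (huW : u ∈ W) : HasCut A H X X' := by
  have key : ∀ a ∈ U, a ∈ W → ∀ w ∈ W, w ≠ a → ∀ b ∈ U, ¬ Feasible A X {a, b, w} := by
    intro a ha haW w hw hwa b hb hf
    have hne := h.split.left.ne_of_feasible (a := a) (b := w) (d := b)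
      (hf.congr (by grind)) hwa.symm
    have := (h.linked.feasible_of_feasible (T := {a, w}) (by grind) hb ha (by grind)
      (hf.congr (by grind))).2
    simp at this
  refine h.hasCut_of_closed hu ?_ ?_
  · intro u' hu' hu'W
    by_contra hne
    obtain ⟨d, hd, hf⟩ := h.split.left.exists_feasible ((h.mem_iff u).2 (.inl hu))
      ((h.mem_iff u').2 (.inl hu')) (Ne.symm hne)
    have hd' := h.split.left.ne_of_feasible hf (Ne.symm hne)
    rcases (h.mem_iff d).1 hd with hdU | hdW
    · exact key u hu huW u' hu'W hne d hdU (hf.congr (by grind))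
    · exact key u hu huW d hdW hd'.1 u' hu' hf
  · intro v hv hvu w hw hf
    exact key u hu huW w hw (h.split.left.ne_of_feasible hf hvu.symm).1 v hv hf

theorem hasCut_of_even (h : MinimalPendant A H X X' z K U W) (hUW : ∀ u ∈ U, u ∉ W)
    (hU : U.Nonempty) (hf : ∀ u ∈ U, Feasible A X (insert u W)) : HasCut A H X X' := by
  obtain ⟨u₀, hu₀, hatt⟩ := h.linked.exists_attachment_left hUW hU hf
  have hXodd : Odd X.card := h.split.left.odd_card ⟨u₀, (h.mem_iff u₀).2 (.inl hu₀)⟩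
  have hUodd : Odd U.card := by
    have h1 := (hf u₀ hu₀).2.even_card
    rw [show X \ insert u₀ W = U.erase u₀ by
      ext x
      have := h.mem_iff x
      grind, Finset.card_erase_of_mem hu₀] at h1
    have := Finset.card_pos.2 hU
    grind
  refine h.hasCut_of_closed hu₀ (fun u hu huW => absurd huW (hUW u hu)) ?_
  intro v hv hvu w hw hfw
  have h1 := (hfw.2.inter (U := U) ?_).even_card
  · rw [show (X \ {u₀, v, w}) ∩ U = (U.erase u₀).erase v by
      ext x
      have := h.mem_iff x
      have := hUW x
      grind, Finset.card_erase_of_mem (by grind), Finset.card_erase_of_mem hu₀] at h1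
    have : 1 < U.card := Finset.one_lt_card.2 ⟨v, hv, u₀, hu₀, hvu⟩
    grind
  · intro a ha b hb haU hbU hab
    have hbW : b ∈ W := by
      have := h.mem_iff b
      grind
    have := hatt a haU b hbW hab
    grind

theorem not_singleton (h : MinimalPendant A H X X' z K U W) {w₀ : V} (hw₀ : w₀ ∈ W)
    (hW : ∀ w ∈ W, w = w₀) (hK : ∀ y ∈ X', y ∉ K → y = z) : False := by
  have hKX : K = X'.erase z := by
    ext x
    have := hK x
    have hxK : x ∈ K → x ∈ X' := fun hx => h.pendant.subset hx
    have := h.pendant.root_notMem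
    grind
  have hz : {u | H.Adj u z} = {w₀} := by
    ext u
    simp only [Set.mem_ofPred_eq, Set.mem_singleton_iff]
    constructor
    · exact fun huz => hW u ((h.mem_outer u).2
        ⟨z, h.pendant.root_mem, h.pendant.root_notMem, huz⟩)
    · rintro rfl
      obtain ⟨y, hyX, hyK, hy⟩ := (h.mem_outer u).1 hw₀
      rwa [← hK y hyX hyK]
  have hcount := incidence_erase_add (H := H) h.pendant.root_mem
  rw [hz, Set.ncard_singleton, ← hKX] at hcount
  have hswap : incidence H X = incidence H X' := by
    rw [incidence_eq_swap, incidence]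
    congr 1
    ext ⟨a, b⟩
    have := h.split.cross a b
    simp only [Set.mem_ofPred_eq]
    grind
  refine h.split.not_perfect fun v => ?_
  have hdeg : {u | H.Adj u v}.ncard ≤ 1 := by
    rcases h.split.cover v with hv | hv
    · have h1 := incidence_erase_add (H := H) hv
      have h2 := h.min_left _ _ (h.split.left.pendant_erase hv h.split.card_left)
      omega
    · have h1 := incidence_erase_add (H := H) hv
      have h2 := h.min_right _ _ (h.split.right.pendant_erase hv h.split.card_right)
      omega
  obtain ⟨w, hw⟩ := h.split.exists_adj v
  exact ⟨w, hw, fun w' hw' => (Set.ncard_le_one (Set.toFinite _)).1 hdeg w' hw' w hw⟩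

theorem hasCut_of_odd (h : MinimalPendant A H X X' z K U W) (hUW : ∀ u ∈ U, u ∉ W)
    {w₀ : V} (hw₀ : w₀ ∈ W) (hf : ∀ u ∈ U, Feasible A X (insert u (W.erase w₀))) :
    HasCut A H X X' := by
  have hKX : ∀ v ∈ K, v ∉ X := fun v hv hvX =>
    h.split.disjoint v hvX (h.pendant.subset hv)
  have hUX : ∀ v ∈ U, v ∈ X := fun v hv => (h.mem_iff v).2 (.inl hv)
  have hWX : ∀ v ∈ W, v ∈ X := fun v hv => (h.mem_iff v).2 (.inr hv)
  have hzX : z ∉ X := fun hzX => h.split.disjoint z hzX h.pendant.root_mem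
  obtain ⟨p, hp⟩ := h.pendant.nonempty
  refine ⟨w₀, hWX w₀ hw₀, z, h.pendant.root_mem, {x | x ∈ K ∨ x ∈ U}, ?_, ?_,
    ⟨p, .inl hp⟩, ?_, ?_⟩
  · simp only [Set.mem_ofPred_eq]
    grind
  · have := h.pendant.root_notMem
    simp only [Set.mem_ofPred_eq]
    grind
  · by_contra! hq
    simp only [Set.mem_ofPred_eq] at hq
    refine h.not_singleton hw₀ (fun w hw => ?_) (fun y hy hyK => ?_)
    · by_contra hne
      have := hq w (by grind) hne
      grind
    · have hyX : y ∉ X := fun hyX => h.split.disjoint y hyX hy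
      exact hq y (by grind) (by grind)
  · simp only [Set.mem_ofPred_eq]
    rintro a (ha | ha) b hb hbw hbz
    · refine ⟨fun hab => ?_, fun hab => hb (.inr ((h.mem_inner b).2 ⟨a, ha, hab.symm⟩))⟩
      exact h.pendant.not_adj h.split.right ha
        (h.split.mem_right_of_inner (h.pendant.subset ha) hab) (by grind) hbz hab
    · refine ⟨fun hab => ?_, fun hab => ?_⟩
      · have hbX := (h.split.inner a b hab).1 (hUX a ha)
        refine hbw (h.linked.attachment_right hUW hw₀ hf ha ?_ hab)
        exact ((h.mem_iff b).1 hbX).resolve_left (by grind)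
      · exact hUW a ha ((h.mem_outer a).2
          ⟨b, h.split.mem_right_of_adj (hUX a ha) hab.symm, by grind, hab⟩)

theorem hasCut (h : MinimalPendant A H X X' z K U W) : HasCut A H X X' := by
  by_cases hUW : ∀ u ∈ U, u ∉ W
  · have hU : U.Nonempty := by
      obtain ⟨v, hv⟩ := h.pendant.nonempty
      obtain ⟨u, hu⟩ := h.split.exists_adj v
      exact ⟨u, (h.mem_inner u).2 ⟨v, hv, hu⟩⟩
    rcases h.linked.feasible_insert_or hUW hU with hf | ⟨w₀, hw₀, hf⟩
    · exact h.hasCut_of_even hUW hU hf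
    · exact h.hasCut_of_odd hUW hw₀ hf
  · push Not at hUW
    obtain ⟨u, hu, huW⟩ := hUW
    exact h.hasCut_of_inter hu huW

end MinimalPendant

theorem Split.hasCut_of_minimal {V : Type} [DecidableEq V] [Finite V] {A H : SimpleGraph V}
    {X X' : Finset V} (h : Split A H X X') {z : V} {K : Finset V} (hp : Pendant A X' z K)
    (hmin : ∀ z' K', Pendant A X z' K' ∨ Pendant A X' z' K' →
      incidence H K ≤ incidence H K') : HasCut A H X X' := by
  have mem_toFinset : ∀ S : Set V, ∀ x, x ∈ (Set.toFinite S).toFinset ↔ x ∈ S := by simp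
  exact MinimalPendant.hasCut ⟨h, hp, fun z' K' h' => hmin z' K' (.inl h'),
    fun z' K' h' => hmin z' K' (.inr h'), mem_toFinset {u | ∃ v ∈ K, H.Adj u v},
    mem_toFinset {w | ∃ y ∈ X', y ∉ K ∧ H.Adj w y}⟩

theorem Split.hasCut {V : Type} [DecidableEq V] [Finite V] {A H : SimpleGraph V}
    {X X' : Finset V} (h : Split A H X X') : HasCut A H X X' := by
  classical
  have hex : ∃ n z K, (Pendant A X z K ∨ Pendant A X' z K) ∧ incidence H K = n := by
    have hcard := h.card_left
    obtain ⟨z, hz⟩ : X.Nonempty := by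
      rw [← Finset.card_pos]
      omega
    exact ⟨_, z, _, .inl (h.left.pendant_erase hz hcard), rfl⟩
  obtain ⟨z, K, hp, hn⟩ := Nat.find_spec hex
  have hmin : ∀ z' K', Pendant A X z' K' ∨ Pendant A X' z' K' →
      incidence H K ≤ incidence H K' := fun z' K' h' =>
    hn ▸ Nat.find_min' hex ⟨z', K', h', rfl⟩
  rcases hp with hp | hp
  · exact (h.symm.hasCut_of_minimal hp fun z' K' h' => hmin z' K' h'.symm).symm
  · exact h.hasCut_of_minimal hp hmin

theorem matchable_of_existsUnique {V : Type} [DecidableEq V] {A H : SimpleGraph V} :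
    ∀ S : Finset V, (∀ v ∈ S, ∃! w, H.Adj w v) → (∀ v ∈ S, ∀ w, H.Adj w v → w ∈ S ∧ A.Adj v w) →
      Matchable A S := by
  intro S
  induction S using Finset.strongInduction with
  | H S ih =>
    intro hH hA
    rcases S.eq_empty_or_nonempty with rfl | ⟨v, hv⟩
    · exact .empty
    obtain ⟨w, hwv, -⟩ := hH v hv
    obtain ⟨hw, hvw⟩ := hA v hv w hwv
    have hne := hvw.ne
    refine (ih (S \ {v, w}) ?_ (fun x hx => hH x (by grind)) ?_).add hvw
      (by grind) (by grind) (by grind)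
    · rw [Finset.ssubset_iff_of_subset (by grind)]
      exact ⟨v, hv, by grind⟩
    · intro x hx y hyx
      have hxS : x ∈ S := by grind
      obtain ⟨hy, hxy⟩ := hA x hxS y hyx
      have h1 : y ≠ v := by
        rintro rfl
        have := (hH y hv).unique hyx.symm hwv
        grind
      have h2 : y ≠ w := by
        rintro rfl
        have := (hH y hw).unique hyx.symm hwv.symm
        grind
      exact ⟨by grind, hxy⟩

theorem Matchable.union {V : Type} [DecidableEq V] {A : SimpleGraph V} {S T : Finset V}
    (hS : Matchable A S) (hT : Matchable A T) (h : Disjoint S T) : Matchable A (S ∪ T) := by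
  rw [Finset.disjoint_left] at h
  induction hS with
  | empty => simpa
  | @insert_edge a b S hab ha hb _ ih =>
    exact (ih fun x hx => h (by grind)).add hab (by grind) (by grind) (by grind)

end WState

namespace Multigraph

open WState

variable {V E : Type} {G : Multigraph V E} {c : E → V → Bool}

theorem Inc.eq_or_eq {e : E} {a b x : V} (ha : G.Inc e a) (hb : G.Inc e b) (hab : a ≠ b)
    (hx : G.Inc e x) : x = a ∨ x = b := by
  unfold Inc at *
  grind

theorem Inc.exists_ne {e : E} {v : V} (hv : G.Inc e v) : ∃ w, w ≠ v ∧ G.Inc e w := by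
  have := G.no_loop e
  rcases hv with rfl | rfl
  · exact ⟨G.snd e, this.symm, .inr rfl⟩
  · exact ⟨G.fst e, this, .inl rfl⟩

/-- The simple graph of pairs of vertices joined by an edge in `F`. -/
def link (G : Multigraph V E) (F : Set E) : SimpleGraph V where
  Adj := G.AdjIn F
  symm := ⟨fun _ _ ⟨hne, e, he, ha, hb⟩ => ⟨hne.symm, e, he, hb, ha⟩⟩
  loopless := ⟨fun _ h => h.1 rfl⟩

theorem IsPerfectMatching.eq_of_inc {M : Set E} (hM : G.IsPerfectMatching M) {e f : E} {v : V}
    (he : e ∈ M) (hf : f ∈ M) (hev : G.Inc e v) (hfv : G.Inc f v) : e = f :=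
  (hM.2 v trivial).unique ⟨he, hev⟩ ⟨hf, hfv⟩

theorem IsPerfectMatching.existsUnique_link {M : Set E} (hM : G.IsPerfectMatching M) (v : V) :
    ∃! w, (G.link M).Adj w v := by
  obtain ⟨e, ⟨he, hev⟩, -⟩ := hM.2 v trivial
  obtain ⟨w, hne, hew⟩ := hev.exists_ne
  refine ⟨w, ⟨hne, e, he, hew, hev⟩, ?_⟩
  rintro u ⟨hne', f, hf, hfu, hfv⟩
  obtain rfl := hM.eq_of_inc he hf hev hfv
  exact (hev.eq_or_eq hew hne.symm hfu).resolve_left hne'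

theorem IsPerfectMatching.matchable [DecidableEq V] {M F : Set E} (hM : G.IsPerfectMatching M)
    {S : Finset V}
    (hS : ∀ v ∈ S, ∀ e ∈ M, G.Inc e v → e ∈ F ∧ ∀ w, G.Inc e w → w ∈ S) :
    Matchable (G.link F) S := by
  refine matchable_of_existsUnique (H := G.link M) S (fun v _ => hM.existsUnique_link v) ?_
  rintro v hv w ⟨hne, e, he, hew, hev⟩
  obtain ⟨heF, hS⟩ := hS v hv e he hev
  exact ⟨hS w hew, hne.symm, e, heF, hev, hew⟩

theorem IsPerfectMatchingOn.insert [DecidableEq V] {M : Set E} {S : Finset V}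
    (hM : G.IsPerfectMatchingOn S M) {e : E} {a b : V} (hab : a ≠ b) (hea : G.Inc e a)
    (heb : G.Inc e b) (ha : a ∉ S) (hb : b ∉ S) :
    G.IsPerfectMatchingOn (insert a (insert b S) : Finset V) (insert e M) := by
  have hinc : ∀ f ∈ M, ∀ v, G.Inc f v → v ∈ S := by
    rintro f hf v (rfl | rfl)
    · exact (hM.1 f hf).1
    · exact (hM.1 f hf).2
  have hend : ∀ v, G.Inc e v → v = a ∨ v = b := fun v => hea.eq_or_eq heb hab
  refine ⟨?_, ?_⟩
  · rintro f (rfl | hf)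
    · have h1 := hend _ (.inl rfl)
      have h2 := hend _ (.inr rfl)
      simp only [Finset.coe_insert, Set.mem_insert_iff]
      grind
    · have := hM.1 f hf
      simp only [Finset.coe_insert, Set.mem_insert_iff]
      grind
  · intro v hv
    by_cases hvS : v ∈ S
    · obtain ⟨f, ⟨hf, hfv⟩, huniq⟩ := hM.2 v hvS
      refine ⟨f, ⟨.inr hf, hfv⟩, ?_⟩
      rintro g ⟨rfl | hg, hgv⟩
      · have := hend v hgv
        grind
      · exact huniq g ⟨hg, hgv⟩
    · have hev : G.Inc e v := by
        simp only [Finset.coe_insert, Set.mem_insert_iff] at hv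
        grind
      refine ⟨e, ⟨.inl rfl, hev⟩, ?_⟩
      rintro g ⟨rfl | hg, hgv⟩
      · rfl
      · exact absurd (hinc g hg v hgv) hvS

theorem exists_isPerfectMatchingOn [DecidableEq V] {F : Set E} {S : Finset V}
    (h : Matchable (G.link F) S) : ∃ M ⊆ F, G.IsPerfectMatchingOn S M := by
  induction h with
  | empty => exact ⟨∅, by simp, by simp [IsPerfectMatchingOn]⟩
  | insert_edge hab ha hb _ ih =>
    obtain ⟨M, hMF, hM⟩ := ih
    obtain ⟨hne, e, he, hea, heb⟩ := hab
    exact ⟨insert e M, Set.insert_subset he hMF, hM.insert hne hea heb ha hb⟩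

theorem IsPerfectMatchingOn.isPerfectMatching {M : Set E} {S : Finset V}
    (hM : G.IsPerfectMatchingOn S M) (hS : ∀ v, v ∈ S) : G.IsPerfectMatching M :=
  ⟨fun _ _ => ⟨trivial, trivial⟩, fun v _ => hM.2 v (hS v)⟩

/-- The bichromatic edges. -/
def BiEdges (G : Multigraph V E) (c : E → V → Bool) : Set E := {e | G.Bichromatic c e}

theorem IsWState.exists_bichromatic (h : G.IsWState c) (v : V) :
    ∃ e, G.Bichromatic c e ∧ G.Inc e v := by
  obtain ⟨e, hev, hc⟩ := h.2.2.1 v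
  refine ⟨e, fun he => ?_, hev⟩
  have h1 := h.2.2.2 e (fun hb => hb he)
  rcases hev with rfl | rfl
  · grind
  · grind

theorem IsWState.eq_of_bichromatic (h : G.IsWState c) {M : Set E} (hM : G.IsPerfectMatching M)
    {e f : E} (he : e ∈ M) (hf : f ∈ M) (hbe : G.Bichromatic c e) (hbf : G.Bichromatic c f) :
    e = f :=
  (h.2.1 M hM).unique ⟨he, hbe⟩ ⟨hf, hbf⟩

theorem not_connectedOn_of_hasCut {X X' : Finset V}
    (h : HasCut (G.link (G.MonoEdges c)) (G.link (G.BiEdges c)) X X') :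
    ∃ x ∈ X, ∃ x' ∈ X', ¬ G.ConnectedOn Set.univ (Set.univ \ {x, x'}) := by
  obtain ⟨x, hx, x', hx', C, hxC, hxC', ⟨p, hp⟩, ⟨q, hq, hqx, hqx'⟩, hC⟩ := h
  refine ⟨x, hx, x', hx', fun hconn => ?_⟩
  have hreach := hconn p (by simp; grind) q (by simp; grind)
  have key : ∀ b, G.ReachOn Set.univ (Set.univ \ {x, x'}) p b → b ∈ C := by
    intro b hb
    induction hb with
    | refl => exact hp
    | tail _ hstep ih =>
      obtain ⟨-, hb, hne, e, -, hea, heb⟩ := hstep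
      by_contra hbC
      simp only [Set.mem_sdiff, Set.mem_univ, true_and, Set.mem_insert_iff,
        Set.mem_singleton_iff, not_or] at hb
      have hno := hC _ ih _ hbC hb.1 hb.2
      by_cases hbi : G.Bichromatic c e
      · exact hno.2 ⟨hne, e, hbi, hea, heb⟩
      · exact hno.1 ⟨hne, e, hbi, hea, heb⟩
  exact hq (key q hreach)

theorem IsCompOn.mem_iff_of_adjIn {F : Set E} {K : Set V} (h : G.IsCompOn F Set.univ K)
    {a b : V} (hab : G.AdjIn F a b) : a ∈ K ↔ b ∈ K := by
  obtain ⟨v, -, rfl⟩ := h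
  have hba : G.AdjIn F b a := (G.link F).adj_symm hab
  exact ⟨fun ha => ⟨trivial, .head ⟨trivial, trivial, hba⟩ ha.2⟩,
    fun hb => ⟨trivial, .head ⟨trivial, trivial, hab⟩ hb.2⟩⟩

/-- A W-state graph whose vertex set is split into two parts not joined by monochromatic
edges. -/
structure MonoSplit (G : Multigraph V E) (c : E → V → Bool) (X X' : Finset V) : Prop where
  isWState : G.IsWState c
  disjoint : ∀ v ∈ X, v ∉ X'
  cover : ∀ v, v ∈ X ∨ v ∈ X'
  inner : ∀ a b, (G.link (G.MonoEdges c)).Adj a b → (a ∈ X ↔ b ∈ X)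
  card_left : 3 ≤ X.card
  card_right : 3 ≤ X'.card

namespace MonoSplit

variable {X X' : Finset V}

theorem symm (h : G.MonoSplit c X X') : G.MonoSplit c X' X where
  isWState := h.isWState
  disjoint v hv hv' := h.disjoint v hv' hv
  cover v := (h.cover v).symm
  inner a b hab := by
    have := h.inner a b hab
    have := h.disjoint
    have := h.cover
    grind
  card_left := h.card_right
  card_right := h.card_left

variable [DecidableEq V]

theorem inc_mem (h : G.MonoSplit c X X') {e : E} (he : ¬ G.Bichromatic c e) {a b : V}
    (hea : G.Inc e a) (heb : G.Inc e b) (ha : a ∈ X) : b ∈ X := by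
  by_cases hab : a = b
  · rwa [← hab]
  · exact (h.inner a b ⟨hab, e, he, hea, heb⟩).1 ha

theorem matchable (h : G.MonoSplit c X X') {M : Set E} (hM : G.IsPerfectMatching M) {e : E}
    (he : e ∈ M) (hbe : G.Bichromatic c e) {S : Finset V}
    (hS : ∀ v, v ∈ S ↔ v ∈ X ∧ ¬ G.Inc e v) : Matchable (G.link (G.MonoEdges c)) S := by
  refine hM.matchable fun v hv f hf hfv => ?_
  rw [hS] at hv
  have hfe : f ≠ e := by
    rintro rfl
    exact hv.2 hfv
  have hbf : ¬ G.Bichromatic c f := fun hbf =>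
    hfe (h.isWState.eq_of_bichromatic hM hf he hbf hbe)
  refine ⟨hbf, fun w hfw => (hS w).2 ⟨h.inc_mem hbf hfv hfw hv.1, fun hew => ?_⟩⟩
  exact hfe (hM.eq_of_inc hf he hfw hew)

theorem feasible (h : G.MonoSplit c X X') {e : E} (hbe : G.Bichromatic c e) {a b : V}
    (ha : a ∈ X) (hb : b ∈ X') (hea : G.Inc e a) (heb : G.Inc e b) :
    Feasible (G.link (G.MonoEdges c)) X {a} := by
  obtain ⟨M, hM, he⟩ := h.isWState.1 e
  refine ⟨by simpa using ha, h.matchable hM he hbe fun v => ?_⟩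
  have hab : a ≠ b := by
    rintro rfl
    exact h.disjoint a ha hb
  have := hea.eq_or_eq heb hab (x := v)
  have := h.disjoint b
  grind

theorem hasCut_of_not_cross (h : G.MonoSplit c X X')
    (hcross : ∀ a ∈ X, ∀ b ∈ X', ¬ (G.link (G.BiEdges c)).Adj a b) :
    HasCut (G.link (G.MonoEdges c)) (G.link (G.BiEdges c)) X X' := by
  obtain ⟨x, hx, p, hp, hxp⟩ := Finset.one_lt_card.1
    (show 1 < X.card by have := h.card_left; omega)
  obtain ⟨x', hx', q, hq, hxq⟩ := Finset.one_lt_card.1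
    (show 1 < X'.card by have := h.card_right; omega)
  have hdisj := h.disjoint
  refine ⟨x, hx, x', hx', {v | v ∈ X ∧ v ≠ x}, by simp, by simp; grind,
    ⟨p, hp, hxp.symm⟩, ⟨q, by simp; grind, by grind, hxq.symm⟩, ?_⟩
  rintro a ⟨ha, -⟩ b hb hbx -
  have hbX : b ∉ X := fun hbX => hb ⟨hbX, hbx⟩
  exact ⟨fun hab => hbX ((h.inner a b hab).1 ha),
    hcross a ha b ((h.cover b).resolve_left hbX)⟩

theorem not_adj_left (h : G.MonoSplit c X X') (hodd : Odd X'.card) {a b : V} (ha : a ∈ X)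
    (hb : b ∈ X) : ¬ (G.link (G.BiEdges c)).Adj a b := by
  rintro ⟨hne, e, hbe, hea, heb⟩
  obtain ⟨M, hM, he⟩ := h.isWState.1 e
  have := (h.symm.matchable hM he hbe (S := X') fun v => by
    have := hea.eq_or_eq heb hne (x := v)
    have := h.disjoint
    grind).even_card
  grind

theorem not_feasible (h : G.MonoSplit c X X') {x₁ x₂ x₃ y₁ y₂ y₃ : V} (hx₁₂ : x₁ ≠ x₂)
    (hx₁₃ : x₁ ≠ x₃) (hx₂₃ : x₂ ≠ x₃) (hy₁₂ : y₁ ≠ y₂) (hy₁₃ : y₁ ≠ y₃) (hy₂₃ : y₂ ≠ y₃)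
    (h₁ : (G.link (G.BiEdges c)).Adj x₁ y₁) (h₂ : (G.link (G.BiEdges c)).Adj x₂ y₂)
    (h₃ : (G.link (G.BiEdges c)).Adj x₃ y₃)
    (hX : Feasible (G.link (G.MonoEdges c)) X {x₁, x₂, x₃}) :
    ¬ Feasible (G.link (G.MonoEdges c)) X' {y₁, y₂, y₃} := by
  intro hX'
  have hx := hX.1
  have hy := hX'.1
  have hdisj := h.disjoint
  obtain ⟨M, -, hM⟩ := exists_isPerfectMatchingOn (hX.2.union hX'.2
    (Finset.disjoint_left.2 (by grind)))
  obtain ⟨hne₁, e₁, he₁, hex₁, hey₁⟩ := h₁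
  obtain ⟨hne₂, e₂, he₂, hex₂, hey₂⟩ := h₂
  obtain ⟨hne₃, e₃, he₃, hex₃, hey₃⟩ := h₃
  have hx₁ : x₁ ∈ X := hx (by simp)
  have hx₂ : x₂ ∈ X := hx (by simp)
  have hx₃ : x₃ ∈ X := hx (by simp)
  have hy₁ : y₁ ∈ X' := hy (by simp)
  have hy₂ : y₂ ∈ X' := hy (by simp)
  have hy₃ : y₃ ∈ X' := hy (by simp)
  have hM' := (((hM.insert hne₁ hex₁ hey₁ (by grind) (by grind)).insert hne₂ hex₂ hey₂
    (by grind) (by grind)).insert hne₃ hex₃ hey₃ (by grind) (by grind)).isPerfectMatching (by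
      intro v
      have := h.cover v
      grind)
  have h12 := h.isWState.eq_of_bichromatic hM' (e := e₁) (f := e₂) (by simp) (by simp) he₁ he₂
  have := hex₁.eq_or_eq hey₁ hne₁ (h12 ▸ hex₂)
  grind

theorem not_perfect [Finite V] (h : G.MonoSplit c X X') :
    ¬ ∀ v, ∃! w, (G.link (G.BiEdges c)).Adj w v := by
  intro hH
  have hmatch : Matchable (G.link (G.BiEdges c)) (X ∪ X') :=
    matchable_of_existsUnique _ (fun v _ => hH v)
      (fun v _ w hw => ⟨Finset.mem_union.2 (h.cover w), hw.symm⟩)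
  obtain ⟨M, hMb, hM⟩ := exists_isPerfectMatchingOn hmatch
  have hM := hM.isPerfectMatching fun v => Finset.mem_union.2 (h.cover v)
  obtain ⟨e, ⟨he, hbe⟩, huniq⟩ := h.isWState.2.1 M hM
  obtain ⟨v, hv, hev⟩ : ∃ v ∈ X, ¬ G.Inc e v := by
    by_contra! hall
    have hcard := h.card_left
    have hsub : X ⊆ {G.fst e, G.snd e} := fun v hv => by
      have := hall v hv
      unfold Inc at this
      grind
    have := (Finset.card_le_card hsub).trans Finset.card_le_two
    omega
  obtain ⟨f, ⟨hf, hfv⟩, -⟩ := hM.2 v trivial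
  exact hev (huniq f ⟨hf, hMb hf⟩ ▸ hfv)

theorem factorCritical (h : G.MonoSplit c X X') (hodd : Odd X'.card) :
    WState.FactorCritical (G.link (G.MonoEdges c)) X := by
  intro x hx
  obtain ⟨e, hbe, hex⟩ := h.isWState.exists_bichromatic x
  obtain ⟨y, hne, hey⟩ := hex.exists_ne
  refine h.feasible hbe hx ((h.cover y).resolve_left fun hy => ?_) hex hey
  exact h.not_adj_left hodd hx hy ⟨hne.symm, e, hbe, hex, hey⟩

theorem hasCut [Finite V] (h : G.MonoSplit c X X') :
    HasCut (G.link (G.MonoEdges c)) (G.link (G.BiEdges c)) X X' := by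
  by_cases hcross : ∀ a ∈ X, ∀ b ∈ X', ¬ (G.link (G.BiEdges c)).Adj a b
  · exact h.hasCut_of_not_cross hcross
  push Not at hcross
  obtain ⟨a, ha, b, hb, hne, e, hbe, hea, heb⟩ := hcross
  have hX := (h.feasible hbe ha hb hea heb).odd_card
  have hX' := (h.symm.feasible hbe hb ha heb hea).odd_card
  refine Split.hasCut ⟨h.disjoint, h.cover, h.inner, ?_, ?_, h.factorCritical hX',
    h.symm.factorCritical hX, h.card_left, h.card_right, ?_, h.not_perfect⟩
  · intro u v huv
    have h1 := fun hu hv => h.not_adj_left hX' hu hv huv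
    have h2 := fun hu hv => h.symm.not_adj_left hX hu hv huv
    have := h.cover u
    have := h.cover v
    have := h.disjoint
    grind
  · intro v
    obtain ⟨f, hbf, hfv⟩ := h.isWState.exists_bichromatic v
    obtain ⟨w, hwv, hfw⟩ := hfv.exists_ne
    exact ⟨w, hwv, f, hbf, hfw, hfv⟩
  · intro _ _ _ _ _ _
    exact h.not_feasible

end MonoSplit

end Multigraph

/-- If both monochromatic components of a W-state graph have at
least 3 vertices, then the graph has a 2-vertex cut `{x, x'}` with `x ∈ X` and
`x' ∈ X'`. -/
theorem stmt13 {V E : Type} [Fintype V] [Fintype E] (G : Multigraph V E)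
    (c : E → V → Bool) (h : G.IsWState c) (X X' : Set V)
    (hd : Disjoint X X') (hu : X ∪ X' = Set.univ)
    (hX : G.IsCompOn (G.MonoEdges c) Set.univ X)
    (hX' : G.IsCompOn (G.MonoEdges c) Set.univ X')
    (hcX : 3 ≤ X.ncard) (hcX' : 3 ≤ X'.ncard) :
    ∃ x ∈ X, ∃ x' ∈ X',
      ¬ G.ConnectedOn Set.univ (Set.univ \ {x, x'}) := by
  classical
  have hsplit : G.MonoSplit c (Set.toFinite X).toFinset (Set.toFinite X').toFinset :=
    { isWState := h
      disjoint := by simpa using Set.disjoint_left.1 hd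
      cover := by simpa using Set.eq_univ_iff_forall.1 hu
      inner := fun a b hab => by simpa using hX.mem_iff_of_adjIn hab
      card_left := by rwa [← Set.ncard_eq_toFinset_card X]
      card_right := by rwa [← Set.ncard_eq_toFinset_card X'] }
  simpa using Multigraph.not_connectedOn_of_hasCut hsplit.hasCut
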